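/- arXiv:1803.09553 — 3 statements merged into one kernel-verified Lean document; each statement's English description precedes it below -/
import Mathlib

section
/- Let r : ℕ be a verification radius, f g : ℕ → ℕ, and let A be a verifier, i.e., a function A : (Fin (2r+1) → ℕ × Bool × ℕ) → ℕ → Bool, that correctly decides At-Least-One-Selected on consistently oriented cycles in the following sense. Completeness: for every n ≥ 3 and every cycle instance of length n whose identifier values lie in {0, …, n−1} and which has x v = true for at least one node v, there exist local certificates ℓ : ZMod n → ℕ with ℓ v < 2^(f n) for all v and a global certificate L < 2^(g n) such that A accepts the certified instance. Soundness: for every n, every m with 3 ≤ m ≤ n, every cycle instance of length m whose identifier values lie in {0, …, n−1} and which has x v = false for all v, every ℓ : ZMod m → ℕ, and every L : ℕ, there exists a node v : ZMod m with A (w_v) L = false. Then for every b ≥ 2, setting n = (b+1)(2r+1), we have b! ≤ 2^(f(n)·(2r+1)·b + g(n)). (Consequently, any mixed proof for At-Least-One-Selected requires local certificates of Ω(log n) bits or a global certificate of Ω(n log n) bits.) -/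
/-- Extension of a permutation of `Fin b` to naturals, with value `b` outside. -/
def permExt {b : ℕ} (π : Equiv.Perm (Fin b)) (j : ℕ) : ℕ :=
  if h : j < b then (π ⟨j, h⟩ : ℕ) else b

theorem permExt_le {b : ℕ} (π : Equiv.Perm (Fin b)) (j : ℕ) : permExt π j ≤ b := by
  unfold permExt; split_ifs <;> omega

theorem permExt_lt {b : ℕ} (π : Equiv.Perm (Fin b)) {j : ℕ} (h : j < b) : permExt π j < b := by
  unfold permExt; rw [dif_pos h]; exact (π ⟨j, h⟩).2

theorem permExt_inj {b : ℕ} (π : Equiv.Perm (Fin b)) {i j : ℕ} (hi : i ≤ b) (hj : j ≤ b)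
    (h : permExt π i = permExt π j) : i = j := by
  unfold permExt at h
  split_ifs at h with h1 h2 h2
  · have := π.injective (Fin.ext h)
    simpa using this
  · have := (π ⟨i, h1⟩).2; omega
  · have := (π ⟨j, h2⟩).2; omega
  · omega

theorem exists_descent {b : ℕ} (σ τ : Equiv.Perm (Fin b)) (h : σ ≠ τ) :
    ∃ j a c : ℕ, j + 1 < b ∧ a < c ∧ c < b ∧ permExt σ j = permExt τ c ∧
      permExt σ (j + 1) = permExt τ a := by
  by_contra hcon
  apply h
  have hstep : ∀ j : ℕ, ∀ h1 : j + 1 < b,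
      (τ⁻¹ (σ ⟨j, by omega⟩)) < τ⁻¹ (σ ⟨j + 1, h1⟩) := by
    intro j h1
    by_contra hlt
    have hne : τ⁻¹ (σ ⟨j, by omega⟩) ≠ τ⁻¹ (σ ⟨j + 1, h1⟩) := by
      intro he
      have := σ.injective (τ⁻¹.injective he)
      simp at this
    have hlt' : τ⁻¹ (σ ⟨j + 1, h1⟩) < τ⁻¹ (σ ⟨j, by omega⟩) :=
      lt_of_le_of_ne (not_lt.mp hlt) hne.symm
    refine hcon ⟨j, (τ⁻¹ (σ ⟨j + 1, h1⟩) : Fin b), (τ⁻¹ (σ ⟨j, by omega⟩) : Fin b), h1, hlt',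
      Fin.is_lt _, ?_, ?_⟩
    · unfold permExt
      rw [dif_pos (by omega), dif_pos (Fin.is_lt _)]
      simp
    · unfold permExt
      rw [dif_pos h1, dif_pos (Fin.is_lt _)]
      simp
  have hmono : StrictMono (τ⁻¹ * σ : Equiv.Perm (Fin b)) := by
    rcases b with _ | b
    · intro x; exact x.elim0
    · rw [Fin.strictMono_iff_lt_succ]
      intro i
      exact hstep i (by omega)
  have hid : (τ⁻¹ * σ : Equiv.Perm (Fin b)) = 1 := by
    ext x
    have e : StrictMono.orderIsoOfSurjective _ hmono (Equiv.surjective _) = OrderIso.refl _ :=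
      Subsingleton.elim _ _
    have := congrArg (fun e : Fin b ≃o Fin b => (e x : ℕ)) e
    simpa using this
  exact (inv_mul_eq_one.mp hid).symm

theorem complete_aux (r : ℕ) (f g : ℕ → ℕ)
    (A : (Fin (2 * r + 1) → ℕ × Bool × ℕ) → ℕ → Bool)
    (complete : ∀ n : ℕ, 3 ≤ n → ∀ (id : ZMod n → ℕ) (x : ZMod n → Bool),
      Function.Injective id → (∀ v, id v < n) → (∃ v, x v = true) →
      ∃ (ℓ : ZMod n → ℕ) (L : ℕ), (∀ v, ℓ v < 2 ^ f n) ∧ L < 2 ^ g n ∧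
        ∀ v : ZMod n,
          A (fun i => (id (v + (i : ℕ) - (r : ℕ)), x (v + (i : ℕ) - (r : ℕ)),
              ℓ (v + (i : ℕ) - (r : ℕ)))) L = true)
    (b s n : ℕ) (hb : 2 ≤ b) (hs : s = 2 * r + 1) (hn : n = (b + 1) * s)
    (π : Equiv.Perm (Fin b)) :
    ∃ (F : Fin (b * s) → Fin (2 ^ f n)) (L : Fin (2 ^ g n)), ∀ u, u + 2 * r < b * s →
      A (fun i => (permExt π ((u + i) / s) * s + (u + i) % s, false,
        if h : permExt π ((u + i) / s) * s + (u + i) % s < b * s then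
          (F ⟨permExt π ((u + i) / s) * s + (u + i) % s, h⟩ : ℕ) else 0)) L = true := by
  have hs0 : 0 < s := by omega
  have hn' : n = b * s + s := by rw [hn]; ring
  have hbs : 2 * s ≤ b * s := Nat.mul_le_mul_right s hb
  have hn3 : 3 ≤ n := by omega
  haveI : NeZero n := ⟨by omega⟩
  have hmod : ∀ q t, (q * s + t % s) % s = t % s := by
    intro q t; rw [Nat.mul_add_mod_self_right, Nat.mod_mod]
  have hdiv : ∀ q t, (q * s + t % s) / s = q := by
    intro q t
    rw [Nat.add_comm, Nat.add_mul_div_right _ _ hs0, Nat.div_eq_of_lt (Nat.mod_lt _ hs0)]; simp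
  have hle : ∀ t, t < n → t / s ≤ b := by
    intro t ht
    have : t / s < b + 1 := by rw [Nat.div_lt_iff_lt_mul hs0, ← hn]; exact ht
    omega
  obtain ⟨ℓ, L, hℓ, hL, hA⟩ := complete n hn3
    (fun v => permExt π (v.val / s) * s + v.val % s) (fun v => decide (b * s ≤ v.val))
    (by
      intro v w h
      have h1 : v.val % s = w.val % s := by
        have := congrArg (· % s) h
        simpa only [hmod] using this
      have h2 : v.val / s = w.val / s := by
        have := congrArg (· / s) h
        simp only [hdiv] at this
        exact permExt_inj π (hle _ v.val_lt) (hle _ w.val_lt) this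
      apply ZMod.val_injective n
      rw [← Nat.div_add_mod v.val s, ← Nat.div_add_mod w.val s, h1, h2])
    (by
      intro v
      have h1 := Nat.mul_le_mul_right s (permExt_le π (v.val / s))
      have h2 := Nat.mod_lt v.val hs0
      show permExt π (v.val / s) * s + v.val % s < n
      omega)
    ⟨((b * s : ℕ) : ZMod n), by
      rw [ZMod.val_natCast_of_lt (by omega)]; simp⟩
  refine ⟨fun t => ⟨ℓ ((permExt π⁻¹ (t / s) * s + t % s : ℕ) : ZMod n), hℓ _⟩, ⟨L, hL⟩, ?_⟩
  intro u hu
  rw [← hA ((u + r : ℕ) : ZMod n)]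
  congr 1
  funext i
  have hi := i.2
  have e : ((u + r : ℕ) : ZMod n) + ((i : ℕ) : ZMod n) - ((r : ℕ) : ZMod n)
      = ((u + i : ℕ) : ZMod n) := by push_cast; ring
  have hui : u + (i : ℕ) < b * s := by omega
  have hq : (u + (i : ℕ)) / s < b := by rw [Nat.div_lt_iff_lt_mul hs0]; exact hui
  have hlt : permExt π ((u + i) / s) * s + (u + i) % s < b * s := by
    have h1 : (permExt π ((u + i) / s) + 1) * s ≤ b * s :=
      Nat.mul_le_mul_right s (permExt_lt π hq)
    have h2 := Nat.mod_lt (u + (i : ℕ)) hs0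
    rw [Nat.add_mul] at h1
    omega
  have hinv : permExt π⁻¹ (permExt π ((u + i) / s)) = (u + i) / s := by
    unfold permExt
    rw [dif_pos hq, dif_pos (Fin.is_lt _)]
    simp
  simp only [e]
  rw [ZMod.val_natCast_of_lt (by omega), dif_pos hlt]
  simp only [hdiv, hmod, hinv]
  rw [Nat.div_add_mod']
  have : ¬ (b * s ≤ u + (i : ℕ)) := by omega
  simp [this]

theorem sound_aux (r : ℕ)
    (A : (Fin (2 * r + 1) → ℕ × Bool × ℕ) → ℕ → Bool)
    (sound : ∀ n m : ℕ, 3 ≤ m → m ≤ n → ∀ (id : ZMod m → ℕ) (x : ZMod m → Bool),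
      Function.Injective id → (∀ v, id v < n) → (∀ v, x v = false) →
      ∀ (ℓ : ZMod m → ℕ) (L : ℕ),
        ∃ v : ZMod m,
          A (fun i => (id (v + (i : ℕ) - (r : ℕ)), x (v + (i : ℕ) - (r : ℕ)),
              ℓ (v + (i : ℕ) - (r : ℕ)))) L = false)
    (s b k : ℕ) (hs : s = 2 * r + 1) (hk : 3 ≤ k * s) (hkb : k ≤ b) (Q : ℕ → ℕ)
    (hQ : ∀ i < k, ∀ j < k, Q i = Q j → i = j) (hQb : ∀ i < k, Q i < b) (F : ℕ → ℕ) (L : ℕ)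
    (hA : ∀ u < k * s, A (fun i => (Q ((u + i) / s % k) * s + (u + i) % s, false,
      F (Q ((u + i) / s % k) * s + (u + i) % s))) L = true) : False := by
  have hs0 : 0 < s := by omega
  haveI : NeZero (k * s) := ⟨by omega⟩
  have hmod : ∀ q t, (q * s + t % s) % s = t % s := by
    intro q t; rw [Nat.mul_add_mod_self_right, Nat.mod_mod]
  have hdiv : ∀ q t, (q * s + t % s) / s = q := by
    intro q t
    rw [Nat.add_comm, Nat.add_mul_div_right _ _ hs0, Nat.div_eq_of_lt (Nat.mod_lt _ hs0)]; simp
  have hlt : ∀ v : ZMod (k * s), v.val / s < k := by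
    intro v
    rw [Nat.div_lt_iff_lt_mul hs0]; exact v.val_lt
  obtain ⟨v, hv⟩ := sound (b * s) (k * s) hk (Nat.mul_le_mul_right s hkb)
    (fun v => Q (v.val / s) * s + v.val % s) (fun _ => false)
    (by
      intro v w h
      have h1 : v.val % s = w.val % s := by
        have := congrArg (· % s) h
        simpa only [hmod] using this
      have h2 : v.val / s = w.val / s := by
        have := congrArg (· / s) h
        simp only [hdiv] at this
        exact hQ _ (hlt v) _ (hlt w) this
      apply ZMod.val_injective (k * s)
      rw [← Nat.div_add_mod v.val s, ← Nat.div_add_mod w.val s, h1, h2])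
    (by
      intro v
      have h1 : (Q (v.val / s) + 1) * s ≤ b * s := Nat.mul_le_mul_right s (hQb _ (hlt v))
      have h2 := Nat.mod_lt v.val hs0
      rw [Nat.add_mul] at h1
      show Q (v.val / s) * s + v.val % s < b * s
      omega)
    (fun _ => rfl) (fun v => F (Q (v.val / s) * s + v.val % s)) L
  have h := hA (v - (r : ℕ)).val (ZMod.val_lt _)
  rw [← Bool.not_eq_true] at hv
  apply hv
  rw [← h]
  congr 1
  funext i
  have e : v + ((i : ℕ) : ZMod (k * s)) - ((r : ℕ) : ZMod (k * s))
      = (((v - (r : ℕ)).val + i : ℕ) : ZMod (k * s)) := by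
    push_cast
    rw [ZMod.natCast_zmod_val]; ring
  simp only [e, ZMod.val_natCast]
  rw [Nat.mod_mul_left_div_self, Nat.mod_mul_left_mod]

/-- Lower bound for mixed proofs for At-Least-One-Selected on consistently
oriented cycles: if a verifier `A` with radius `r`, local certificates of `f n`
bits and a global certificate of `g n` bits correctly decides ALOS, then for
every `b ≥ 2`, with `n = (b+1)(2r+1)`, we have `b! ≤ 2^(f(n)·(2r+1)·b + g(n))`. -/
theorem alos_mixed_proof_lower_bound (r : ℕ) (f g : ℕ → ℕ)
    (A : (Fin (2 * r + 1) → ℕ × Bool × ℕ) → ℕ → Bool)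
    (complete : ∀ n : ℕ, 3 ≤ n → ∀ (id : ZMod n → ℕ) (x : ZMod n → Bool),
      Function.Injective id → (∀ v, id v < n) → (∃ v, x v = true) →
      ∃ (ℓ : ZMod n → ℕ) (L : ℕ), (∀ v, ℓ v < 2 ^ f n) ∧ L < 2 ^ g n ∧
        ∀ v : ZMod n,
          A (fun i => (id (v + (i : ℕ) - (r : ℕ)), x (v + (i : ℕ) - (r : ℕ)),
              ℓ (v + (i : ℕ) - (r : ℕ)))) L = true)
    (sound : ∀ n m : ℕ, 3 ≤ m → m ≤ n → ∀ (id : ZMod m → ℕ) (x : ZMod m → Bool),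
      Function.Injective id → (∀ v, id v < n) → (∀ v, x v = false) →
      ∀ (ℓ : ZMod m → ℕ) (L : ℕ),
        ∃ v : ZMod m,
          A (fun i => (id (v + (i : ℕ) - (r : ℕ)), x (v + (i : ℕ) - (r : ℕ)),
              ℓ (v + (i : ℕ) - (r : ℕ)))) L = false) :
    ∀ b : ℕ, 2 ≤ b →
      Nat.factorial b ≤
        2 ^ (f ((b + 1) * (2 * r + 1)) * (2 * r + 1) * b + g ((b + 1) * (2 * r + 1))) := by
  intro b hb
  by_contra hcon
  push Not at hcon
  obtain ⟨s, hs⟩ : ∃ s, s = 2 * r + 1 := ⟨_, rfl⟩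
  obtain ⟨n, hn⟩ : ∃ n, n = (b + 1) * s := ⟨_, rfl⟩
  have hs0 : 0 < s := by omega
  rw [← hs, ← hn] at hcon
  choose F L hFL using complete_aux r f g A complete b s n hb hs hn
  by_cases hr : r = 0
  · subst hr
    have hs1 : s = 1 := by omega
    subst hs1
    by_cases hb3 : 3 ≤ b
    · refine sound_aux 0 A sound 1 b b rfl (by omega) le_rfl (permExt (1 : Equiv.Perm (Fin b)))
        (fun i hi j hj h => permExt_inj _ hi.le hj.le h) (fun i hi => permExt_lt _ hi)
        (fun t => if h : t < b * 1 then (F 1 ⟨t, h⟩ : ℕ) else 0) (L 1) ?_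
      intro u hu
      rw [← hFL 1 u (by omega)]
      congr 1
      funext i
      have hi : (u + (i : ℕ)) / 1 % b = (u + i) / 1 := by
        apply Nat.mod_eq_of_lt
        rw [Nat.div_one]
        omega
      simp only [hi]
    · have hb2 : b = 2 := by omega
      subst hb2
      have hn3 : n = 3 := by omega
      subst hn3
      have h2 : f 3 * 1 * 2 + g 3 < 1 := by
        by_contra h
        have := Nat.pow_le_pow_right (n := 2) (by norm_num) (not_lt.mp h)
        simp only [Nat.factorial] at hcon
        omega
      have hf : f 3 = 0 := by omega
      have hg : g 3 = 0 := by omega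
      obtain ⟨v, hv⟩ := sound 3 3 le_rfl le_rfl (fun v => v.val) (fun _ => false)
        (ZMod.val_injective 3) (fun v => v.val_lt) (fun _ => rfl) (fun _ => 0) 0
      obtain ⟨ℓ, L', h1, h2, h3⟩ := complete 3 le_rfl (fun v => v.val)
        (fun w => decide (w = v + 1))
        (ZMod.val_injective 3) (fun v => v.val_lt) ⟨v + 1, by simp⟩
      rw [hg] at h2
      rw [hf] at h1
      have hL' : L' = 0 := by omega
      have hℓ : ∀ v, ℓ v = 0 := fun v => by have := h1 v; omega
      have h4 := h3 v
      rw [← Bool.not_eq_true] at hv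
      apply hv
      rw [← h4, hL']
      congr 1
      funext i
      have hi : (i : ℕ) = 0 := by omega
      simp [hi, hℓ]
  · have hcard : Fintype.card ((Fin (b * s) → Fin (2 ^ f n)) × Fin (2 ^ g n))
        < Fintype.card (Equiv.Perm (Fin b)) := by
      rw [Fintype.card_perm, Fintype.card_prod, Fintype.card_fun]
      simp only [Fintype.card_fin]
      rw [← pow_mul, ← pow_add]
      calc _ = 2 ^ (f n * s * b + g n) := by congr 2; ring
        _ < _ := hcon
    obtain ⟨σ, τ, hne, heq⟩ := Fintype.exists_ne_map_eq_of_card_lt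
      (fun π => (F π, L π)) hcard
    simp only [Prod.mk.injEq] at heq
    obtain ⟨hF, hL⟩ := heq
    obtain ⟨j, a, c, hj, hac, hcb, hσc, hσa⟩ := exists_descent σ τ hne
    obtain ⟨k, hk⟩ : ∃ k, c = a + k := ⟨c - a, by omega⟩
    have hbig : 2 * s ≤ (k + 1) * s := Nat.mul_le_mul_right s (by omega)
    refine sound_aux r A sound s b (k + 1) hs (by omega) (by omega) (fun i => permExt τ (a + i))
      (fun i hi j hj h => by
        have := permExt_inj τ (i := a + i) (j := a + j) (by omega) (by omega) h
        omega)
      (fun i hi => permExt_lt τ (by omega))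
      (fun t => if h : t < b * s then (F τ ⟨t, h⟩ : ℕ) else 0) (L τ) ?_
    intro u hu
    have hks : (k + 1) * s = k * s + s := by ring
    by_cases hu2 : u + 2 * r < (k + 1) * s
    · have hle : a * s + (k + 1) * s ≤ b * s := by
        rw [← Nat.add_mul]; exact Nat.mul_le_mul_right s (by omega)
      rw [← hFL τ (a * s + u) (by omega)]
      congr 1
      funext i
      have hi := i.2
      have h1 : (u + (i : ℕ)) / s % (k + 1) = (u + i) / s := by
        apply Nat.mod_eq_of_lt
        rw [Nat.div_lt_iff_lt_mul hs0]
        omega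
      have h2 : (a * s + u + (i : ℕ)) / s = a + (u + i) / s := by
        rw [Nat.add_assoc, Nat.add_comm, Nat.add_mul_div_right _ _ hs0, Nat.add_comm]
      have h3 : (a * s + u + (i : ℕ)) % s = (u + i) % s := by
        rw [Nat.add_assoc, Nat.mul_add_mod_self_right]
      simp only [h1, h2, h3]
    · obtain ⟨w, hw⟩ : ∃ w, u = k * s + w := ⟨u - k * s, by omega⟩
      have hle : j * s + 2 * s ≤ b * s := by
        rw [← Nat.add_mul]; exact Nat.mul_le_mul_right s (by omega)
      rw [← hL, ← hF, ← hFL σ (j * s + w) (by omega)]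
      congr 1
      funext i
      have hi := i.2
      have h2 : (j * s + w + (i : ℕ)) / s = j + (w + i) / s := by
        rw [Nat.add_assoc, Nat.add_comm, Nat.add_mul_div_right _ _ hs0, Nat.add_comm]
      have h3 : (j * s + w + (i : ℕ)) % s = (w + i) % s := by
        rw [Nat.add_assoc, Nat.mul_add_mod_self_right]
      have h2' : (u + (i : ℕ)) / s = k + (w + i) / s := by
        rw [hw, Nat.add_assoc, Nat.add_comm, Nat.add_mul_div_right _ _ hs0, Nat.add_comm]
      have h3' : (u + (i : ℕ)) % s = (w + i) % s := by
        rw [hw, Nat.add_assoc, Nat.mul_add_mod_self_right]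
      have h4 : permExt τ (a + (u + (i : ℕ)) / s % (k + 1))
          = permExt σ ((j * s + w + (i : ℕ)) / s) := by
        rw [h2, h2']
        by_cases hwi : w + (i : ℕ) < s
        · rw [Nat.div_eq_of_lt hwi, Nat.add_zero, Nat.mod_eq_of_lt (by omega),
            Nat.add_zero, hσc, hk]
        · have : (w + (i : ℕ)) / s = 1 := by
            apply Nat.div_eq_of_lt_le <;> omega
          rw [this, Nat.mod_self, hσa, Nat.add_zero]
      simp only [h4, h3, h3']
end

section
/- Let r : ℕ be a verification radius, f g : ℕ → ℕ, and let A be a verifier, i.e., a function A : (Fin (2r+1) → ℕ × ℕ) → ℕ → Bool, that correctly decides Odd-Cycle on consistently oriented cycles in the following sense. Completeness: for every odd n ≥ 3 and every cycle instance of length n whose identifier values lie in {0, …, n−1}, there exist local certificates ℓ : ZMod n → ℕ with ℓ v < 2^(f n) for all v and a global certificate L < 2^(g n) such that A accepts the certified instance. Soundness: for every n, every even m with 4 ≤ m ≤ n, every cycle instance of length m whose identifier values lie in {0, …, n−1}, every ℓ : ZMod m → ℕ, and every L : ℕ, there exists a node v : ZMod m with A (w_v) L = false. Then for every even b ≥ 2,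 setting n = (b+1)(2r+1), we have ((b/2)!)² ≤ 2^(f(n)·(2r+1)·b + g(n)). (Consequently, any mixed proof for Odd-Cycle requires local certificates of Ω(log n) bits or a global certificate of Ω(n log n) bits.) -/
/-- Identifier at position `q` when the blocks (of size `s`) are laid out along `c`. -/
def nodeId (s : ℕ) (c : ℕ → ℕ) (q : ℕ) : ℕ := c (q / s) * s + q % s

/-- Identifier seen at offset `i` starting at offset `t` of block `u`, followed by block `w`. -/
def pairId (s u w t i : ℕ) : ℕ := if t + i < s then u * s + (t + i) else w * s + (t + i - s)

theorem nodeId_block (s : ℕ) (c : ℕ → ℕ) (a x : ℕ) (hx : x < s) :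
    nodeId s c (a * s + x) = c a * s + x := by
  have hs : 0 < s := by omega
  have h1 : (a * s + x) / s = a := by
    rw [mul_comm, Nat.mul_add_div hs, Nat.div_eq_of_lt hx, add_zero]
  have h2 : (a * s + x) % s = x := by
    rw [mul_comm, Nat.mul_add_mod, Nat.mod_eq_of_lt hx]
  rw [nodeId, h1, h2]

theorem block_lt {a x M s : ℕ} (ha : a < M) (hx : x < s) : a * s + x < M * s := by
  have : (a + 1) * s ≤ M * s := Nat.mul_le_mul_right _ ha
  rw [add_mul] at this
  omega

theorem window_eq (r M m : ℕ) (hM : 0 < M) (hm : m = M * (2 * r + 1)) (c : ℕ → ℕ) (v : ZMod m)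
    (a t : ℕ) (ha : a < M) (ht : t < 2 * r + 1)
    (hv : (v - (r : ℕ)).val = a * (2 * r + 1) + t) (i : ℕ) (hi : i < 2 * r + 1) :
    nodeId (2 * r + 1) c (v + (i : ℕ) - (r : ℕ)).val =
      pairId (2 * r + 1) (c a) (c ((a + 1) % M)) t i := by
  have hm0 : 0 < m := by rw [hm]; positivity
  have : NeZero m := ⟨hm0.ne'⟩
  have e : v + (i : ZMod m) - (r : ZMod m) = (v - (r : ZMod m)) + (i : ZMod m) := by ring
  rw [e, ZMod.val_add, ZMod.val_natCast, Nat.add_mod_mod, hv, pairId]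
  generalize 2 * r + 1 = s at *
  split_ifs with h
  · have := block_lt ha h
    rw [add_assoc, Nat.mod_eq_of_lt (by omega), nodeId_block _ _ _ _ h]
  · have hx : t + i - s < s := by omega
    have e2 : a * s + t + i = (a + 1) * s + (t + i - s) := by
      rw [add_mul]; omega
    rw [e2]
    rcases Nat.lt_or_ge (a + 1) M with h1 | h1
    · have := block_lt h1 hx
      rw [Nat.mod_eq_of_lt (by omega), nodeId_block _ _ _ _ hx, Nat.mod_eq_of_lt h1]
    · have h2 : a + 1 = M := by omega
      have := block_lt hM hx
      rw [h2, ← hm, Nat.add_mod_left, Nat.mod_eq_of_lt (by omega), Nat.mod_self]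
      have := nodeId_block s c 0 _ hx
      simpa using this

theorem nodeId_inj (s M m : ℕ) (hm0 : 0 < m) (hm : m = M * s) (c : ℕ → ℕ)
    (hc : Function.Injective c) :
    Function.Injective (fun v : ZMod m => nodeId s c v.val) := by
  have : NeZero m := ⟨hm0.ne'⟩
  have hs : 0 < s := Nat.pos_of_ne_zero (by rintro rfl; omega)
  intro v w h
  simp only [nodeId] at h
  have hv := Nat.mod_lt v.val hs
  have hw := Nat.mod_lt w.val hs
  have h1 := congrArg (· / s) h
  have h2 := congrArg (· % s) h
  simp only [mul_comm _ s, Nat.mul_add_div hs, Nat.mul_add_mod, Nat.mod_mod,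
    Nat.div_eq_of_lt hv, Nat.div_eq_of_lt hw, add_zero] at h1 h2
  apply ZMod.val_injective
  rw [← Nat.div_add_mod v.val s, ← Nat.div_add_mod w.val s, hc h1, h2]

theorem nodeId_lt (s M m B : ℕ) (hm0 : 0 < m) (hm : m = M * s) (c : ℕ → ℕ)
    (hc : ∀ q, q < M → c q < B) (v : ZMod m) : nodeId s c v.val < B * s := by
  have : NeZero m := ⟨hm0.ne'⟩
  have hs : 0 < s := Nat.pos_of_ne_zero (by rintro rfl; omega)
  refine block_lt (hc _ ?_) (Nat.mod_lt _ hs)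
  rw [Nat.div_lt_iff_lt_mul hs, ← hm]
  exact ZMod.val_lt v

/-- A permutation of the first `b` numbers extended by the identity. -/
def extSeq {b : ℕ} (p : Equiv.Perm (Fin b)) (q : ℕ) : ℕ := if h : q < b then (p ⟨q, h⟩).val else q

theorem extSeq_of_lt {b : ℕ} (p : Equiv.Perm (Fin b)) (q : ℕ) (h : q < b) :
    extSeq p q = (p ⟨q, h⟩).val := by simp [extSeq, h]

theorem extSeq_lt {b : ℕ} (p : Equiv.Perm (Fin b)) (q : ℕ) (h : q < b) : extSeq p q < b := by
  simp [extSeq, h]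

theorem extSeq_inj {b : ℕ} (p : Equiv.Perm (Fin b)) : Function.Injective (extSeq p) := by
  intro x y h
  unfold extSeq at h
  split_ifs at h with h1 h2 h2
  · have := p.injective (Fin.ext h)
    simpa using this
  · have := (p ⟨x, h1⟩).isLt
    omega
  · have := (p ⟨y, h2⟩).isLt
    omega
  · exact h

/-- Two distinct Hamiltonian paths: the second has an edge going backwards in the first. -/
theorem exists_back {b : ℕ} (p p' : Equiv.Perm (Fin b)) (hne : p ≠ p') :
    ∃ (a : ℕ) (ha : a + 1 < b) (i j : Fin b), i ≤ j ∧ p' ⟨a, by omega⟩ = p j ∧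
      p' ⟨a + 1, ha⟩ = p i := by
  by_contra hcon
  push Not at hcon
  apply hne
  have hmono : StrictMono (fun x => p.symm (p' x)) := by
    rcases b with _ | b
    · intro x; exact x.elim0
    rw [Fin.strictMono_iff_lt_succ]
    intro x
    by_contra hx
    push Not at hx
    refine hcon x.val (by omega) _ _ hx ?_ ?_
    · rw [Equiv.apply_symm_apply]; rfl
    · rw [Equiv.apply_symm_apply]; rfl
  have := (StrictMono.range_inj hmono strictMono_id).1 (by
    rw [Set.range_id]
    exact ((p'.trans p.symm).surjective).range_eq)
  ext x
  have h := congrFun this x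
  simp only [id] at h
  rw [Equiv.symm_apply_eq] at h
  rw [h]

/-- Alternating orders. -/
def altPerm {k : ℕ} (π : Fin 2 → Equiv.Perm (Fin k)) : Equiv.Perm (Fin (k * 2)) :=
  (finProdFinEquiv.symm.trans (Equiv.prodCongrLeft π)).trans finProdFinEquiv

theorem altPerm_inj {k : ℕ} : Function.Injective (altPerm (k := k)) := by
  intro π π' h
  funext y
  ext x
  have := congrArg (fun e => finProdFinEquiv.symm (e (finProdFinEquiv (x, y)))) h
  simp [altPerm] at this
  rw [this]

theorem altPerm_parity {k : ℕ} (π : Fin 2 → Equiv.Perm (Fin k)) (x : Fin (k * 2)) :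
    (altPerm π x).val % 2 = x.val % 2 := by
  obtain ⟨⟨y, z⟩, rfl⟩ := finProdFinEquiv.surjective x
  simp [altPerm, finProdFinEquiv]

/-- Lower bound for mixed proofs for Odd-Cycle on consistently oriented cycles:
if a verifier `A` with radius `r`, local certificates of `f n` bits and a global
certificate of `g n` bits correctly decides Odd-Cycle, then for every even
`b ≥ 2`, with `n = (b+1)(2r+1)`, we have `((b/2)!)² ≤ 2^(f(n)·(2r+1)·b + g(n))`. -/
theorem odd_cycle_mixed_proof_lower_bound (r : ℕ) (f g : ℕ → ℕ)
    (A : (Fin (2 * r + 1) → ℕ × ℕ) → ℕ → Bool)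
    (complete : ∀ n : ℕ, 3 ≤ n → Odd n → ∀ id : ZMod n → ℕ,
      Function.Injective id → (∀ v, id v < n) →
      ∃ (ℓ : ZMod n → ℕ) (L : ℕ), (∀ v, ℓ v < 2 ^ f n) ∧ L < 2 ^ g n ∧
        ∀ v : ZMod n,
          A (fun i => (id (v + (i : ℕ) - (r : ℕ)), ℓ (v + (i : ℕ) - (r : ℕ)))) L = true)
    (sound : ∀ n m : ℕ, 4 ≤ m → m ≤ n → Even m → ∀ id : ZMod m → ℕ,
      Function.Injective id → (∀ v, id v < n) →
      ∀ (ℓ : ZMod m → ℕ) (L : ℕ),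
        ∃ v : ZMod m,
          A (fun i => (id (v + (i : ℕ) - (r : ℕ)), ℓ (v + (i : ℕ) - (r : ℕ)))) L = false) :
    ∀ b : ℕ, 2 ≤ b → Even b →
      Nat.factorial (b / 2) ^ 2 ≤
        2 ^ (f ((b + 1) * (2 * r + 1)) * (2 * r + 1) * b + g ((b + 1) * (2 * r + 1))) := by
  intro b hb2 hbe
  obtain ⟨k, rfl⟩ : ∃ k, b = k * 2 := by
    obtain ⟨k, rfl⟩ := hbe; exact ⟨k, by omega⟩
  rw [Nat.mul_div_cancel _ (by norm_num)]
  -- the case of one pair is trivial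
  rcases Nat.lt_or_ge k 2 with hk | hk
  · obtain rfl : k = 1 := by omega
    simpa using Nat.one_le_two_pow
  set n := (k * 2 + 1) * (2 * r + 1) with hn
  have hn5 : 5 ≤ n := by nlinarith
  have hnodd : Odd n := Odd.mul ⟨k, by ring⟩ ⟨r, rfl⟩
  -- labels as functions of identifiers
  have key : ∀ p : Equiv.Perm (Fin (k * 2)), ∃ (lab : ℕ → ℕ) (L : ℕ),
      (∀ x, lab x < 2 ^ f n) ∧ L < 2 ^ g n ∧
      ∀ a < k * 2 + 1, ∀ t < 2 * r + 1,
        A (fun i => (pairId (2 * r + 1) (extSeq p a) (extSeq p ((a + 1) % (k * 2 + 1))) t i,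
          lab (pairId (2 * r + 1) (extSeq p a) (extSeq p ((a + 1) % (k * 2 + 1))) t i))) L
            = true := by
    intro p
    have hinj := nodeId_inj (2 * r + 1) (k * 2 + 1) n (by omega) hn (extSeq p) (extSeq_inj p)
    obtain ⟨l, L, hl, hL, hacc⟩ := complete n (by omega) hnodd _ hinj
      (fun v => nodeId_lt (2 * r + 1) (k * 2 + 1) n (k * 2 + 1) (by omega) hn (extSeq p) (by
        intro q hq
        rcases Nat.lt_or_ge q (k * 2) with h | h
        · have := extSeq_lt p q h
          omega
        · simp only [extSeq]
          rw [dif_neg (by omega)]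
          exact hq) v)
    refine ⟨Function.extend (fun v : ZMod n => nodeId (2 * r + 1) (extSeq p) v.val) l
      (fun _ => 0), L, ?_, hL, ?_⟩
    · intro x
      by_cases hx : ∃ v : ZMod n, nodeId (2 * r + 1) (extSeq p) v.val = x
      · obtain ⟨v, rfl⟩ := hx
        have := hinj.extend_apply l (fun _ => 0) v
        rw [this]
        exact hl v
      · rw [Function.extend_apply' _ _ _ hx]
        positivity
    · intro a ha t ht
      have h := hacc (((a * (2 * r + 1) + t : ℕ) : ZMod n) + (r : ℕ))
      rw [← h]
      congr 1
      funext i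
      have hw := window_eq r (k * 2 + 1) n (by omega) hn (extSeq p)
        (((a * (2 * r + 1) + t : ℕ) : ZMod n) + (r : ℕ)) a t ha ht (by
          rw [add_sub_cancel_right, ZMod.val_natCast]
          exact Nat.mod_eq_of_lt (block_lt ha ht)) i i.isLt
      have hx := hinj.extend_apply l (fun _ => 0)
        (((a * (2 * r + 1) + t : ℕ) : ZMod n) + (r : ℕ) + (i : ℕ) - (r : ℕ))
      rw [← hw, hx]
  choose lab L hlab hL hacc using key
  by_contra hlt
  push Not at hlt
  -- the radius zero case is contradictory
  rcases Nat.eq_zero_or_pos r with hr | hr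
  · subst hr
    obtain ⟨v, hv⟩ := sound n 4 le_rfl (by omega) ⟨2, rfl⟩ (fun v => v.val)
      (ZMod.val_injective 4) (fun v => lt_of_lt_of_le (ZMod.val_lt v) (by omega))
      (fun v => lab 1 v.val) (L 1)
    have hv4 : v.val < 4 := ZMod.val_lt v
    have h := hacc 1 v.val (by omega) 0 (by omega)
    have e : ∀ i : Fin (2 * 0 + 1), (v + ((i : ℕ) : ZMod 4) - ((0 : ℕ) : ZMod 4)) = v := by
      intro i
      have : (i : ℕ) = 0 := by omega
      simp [this]
    have e2 : ∀ i : Fin (2 * 0 + 1), pairId (2 * 0 + 1)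
        (extSeq (1 : Equiv.Perm (Fin (k * 2))) v.val)
        (extSeq (1 : Equiv.Perm (Fin (k * 2))) ((v.val + 1) % (k * 2 + 1))) 0 i = v.val := by
      intro i
      have : (i : ℕ) = 0 := by omega
      simp [pairId, this, extSeq]
    simp only [e] at hv
    simp only [e2] at h
    rw [h] at hv
    exact absurd hv (by simp)
  -- pigeonhole
  let F : (Fin 2 → Equiv.Perm (Fin k)) →
      (Fin (k * 2 * (2 * r + 1)) → Fin (2 ^ f n)) × Fin (2 ^ g n) :=
    fun π => (fun x => ⟨lab (altPerm π) x, hlab _ _⟩, ⟨L (altPerm π), hL _⟩)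
  obtain ⟨π, π', hne, hF⟩ := Fintype.exists_ne_map_eq_of_card_lt F (by
    simp only [Fintype.card_prod, Fintype.card_fun, Fintype.card_fin, Fintype.card_perm]
    refine lt_of_eq_of_lt ?_ hlt
    rw [← pow_mul, ← pow_add]
    congr 2
    ring)
  have hLL : L (altPerm π) = L (altPerm π') := by
    have := congrArg (fun z => (z.2 : ℕ)) hF
    exact this
  have hlabs : ∀ x, x < k * 2 * (2 * r + 1) → lab (altPerm π) x = lab (altPerm π') x := by
    intro x hx
    have := congrArg (fun z => (z.1 ⟨x, hx⟩ : ℕ)) hF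
    exact this
  obtain ⟨a, ha, i, j, hij, hj, hi⟩ := exists_back (altPerm π) (altPerm π')
    (fun h => hne (altPerm_inj h))
  have p1 := altPerm_parity π i
  have p2 := altPerm_parity π j
  have p3 := altPerm_parity π' ⟨a, by omega⟩
  have p4 := altPerm_parity π' ⟨a + 1, ha⟩
  rw [hj] at p3
  rw [hi] at p4
  simp only at p3 p4
  have hij' : i.val ≤ j.val := hij
  obtain ⟨M, hM⟩ : ∃ M, M = j.val - i.val + 1 := ⟨_, rfl⟩
  have hM2 : 2 ≤ M := by omega
  have hMe : Even M := by rw [Nat.even_iff]; omega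
  have hjb := j.isLt
  have hm6 : 2 * 3 ≤ M * (2 * r + 1) := Nat.mul_le_mul hM2 (by omega)
  have hcinj : Function.Injective (fun q => extSeq (altPerm π) (i.val + q)) := by
    intro x y h
    have := extSeq_inj _ h
    omega
  have hcl : ∀ q, q < M → (fun q => extSeq (altPerm π) (i.val + q)) q < k * 2 := by
    intro q hq
    exact extSeq_lt _ _ (by omega)
  have hidlt := nodeId_lt (2 * r + 1) M (M * (2 * r + 1)) (k * 2) (by omega) rfl _ hcl
  have hle : M * (2 * r + 1) ≤ n := Nat.mul_le_mul_right _ (by omega)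
  have hbn : k * 2 * (2 * r + 1) ≤ n := Nat.mul_le_mul_right _ (by omega)
  obtain ⟨v, hv⟩ := sound n (M * (2 * r + 1)) (by omega) hle (hMe.mul_right _) _
    (nodeId_inj (2 * r + 1) M (M * (2 * r + 1)) (by omega) rfl _ hcinj)
    (fun v => lt_of_lt_of_le (hidlt v) hbn)
    (fun v => lab (altPerm π) (nodeId (2 * r + 1)
      (fun q => extSeq (altPerm π) (i.val + q)) v.val)) (L (altPerm π))
  have : NeZero (M * (2 * r + 1)) := ⟨by omega⟩
  have hs : 0 < 2 * r + 1 := by omega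
  obtain ⟨q, hq⟩ : ∃ q, q = (v - (r : ℕ)).val := ⟨_, rfl⟩
  have hqlt : q < M * (2 * r + 1) := by rw [hq]; exact ZMod.val_lt _
  have hqa : q / (2 * r + 1) < M := by rwa [Nat.div_lt_iff_lt_mul hs]
  have hqt := Nat.mod_lt q hs
  have hqe : (v - (r : ℕ)).val = q / (2 * r + 1) * (2 * r + 1) + q % (2 * r + 1) := by
    rw [← hq, Nat.div_add_mod']
  have hw := fun x : Fin (2 * r + 1) => window_eq r M (M * (2 * r + 1)) (by omega) rfl
    (fun q => extSeq (altPerm π) (i.val + q)) v _ _ hqa hqt hqe x x.isLt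
  simp only [hw] at hv
  generalize q / (2 * r + 1) = a' at *
  generalize q % (2 * r + 1) = t at *
  rcases Nat.lt_or_ge (a' + 1) M with h1 | h1
  · -- an edge of the first path
    have h := hacc (altPerm π) (i.val + a') (by omega) t hqt
    rw [Nat.mod_eq_of_lt (by omega)] at h
    rw [Nat.mod_eq_of_lt h1, ← add_assoc, h] at hv
    exact absurd hv (by simp)
  · -- the backward edge, taken from the second path
    have h2 : a' + 1 = M := by omega
    have h := hacc (altPerm π') a (by omega) t hqt
    rw [Nat.mod_eq_of_lt (by omega)] at h
    have e1 : extSeq (altPerm π) (i.val + a') = extSeq (altPerm π') a := by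
      have : i.val + a' = j.val := by omega
      rw [this, extSeq_of_lt _ _ hjb, extSeq_of_lt _ a (by omega), hj]
    have e2 : extSeq (altPerm π) (i.val + 0) = extSeq (altPerm π') (a + 1) := by
      rw [add_zero, extSeq_of_lt _ _ i.isLt, extSeq_of_lt _ _ ha, hi]
    rw [h2, Nat.mod_self, e1, e2] at hv
    have e3 : ∀ x : Fin (2 * r + 1), lab (altPerm π) (pairId (2 * r + 1)
        (extSeq (altPerm π') a) (extSeq (altPerm π') (a + 1)) t x) =
        lab (altPerm π') (pairId (2 * r + 1)
        (extSeq (altPerm π') a) (extSeq (altPerm π') (a + 1)) t x) := by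
      intro x
      apply hlabs
      have hx := x.isLt
      unfold pairId
      split_ifs with h5
      · exact block_lt (extSeq_lt _ _ (by omega)) h5
      · exact block_lt (extSeq_lt _ _ ha) (by omega)
    simp only [e3, hLL] at hv
    rw [h] at hv
    exact absurd hv (by simp)
end

section
/- For every n : ℕ with n! · 2^n ≤ 2^(n.choose 2), there exists a function φ : SimpleGraph (Fin n) → (Fin n → Bool) that is constant on isomorphism classes (if Nonempty (G ≃g H) then φ G = φ H) and surjective onto all n-bit vectors Fin n → Bool. (This is the encoding of n-bit communication-complexity inputs by graph isomorphism classes used to build the language L_f; it requires distinct bit vectors to have disjoint preimages, which is guaranteed since φ is a function, and surjectivity, which is possible because there are at least 2^(n choose 2)/n! ≥ 2^n isomorphism classes.) -/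
lemma aux_card_graphs (n : ℕ) : 2 ^ n.choose 2 ≤ Nat.card (SimpleGraph (Fin n)) := by
  classical
  have h1 : Nat.card (Set {e : Sym2 (Fin n) // ¬ e.IsDiag}) = 2 ^ n.choose 2 := by
    rw [Nat.card_eq_fintype_card, Fintype.card_set, Sym2.card_subtype_not_diag, Fintype.card_fin]
  rw [← h1]
  refine Nat.card_le_card_of_injective
    (fun s => SimpleGraph.fromEdgeSet (Set.image Subtype.val s)) ?_
  intro s t hst
  have h2 := congrArg SimpleGraph.edgeSet hst
  simp only [SimpleGraph.edgeSet_fromEdgeSet] at h2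
  ext ⟨e, he⟩
  have h3 := Set.ext_iff.1 h2 e
  simpa [he] using h3

/-- If `n! · 2^n ≤ 2^(n choose 2)`, then there is an encoding of `n`-bit vectors
by isomorphism classes of simple graphs on `Fin n`: a map `φ` from graphs to
bit vectors that is constant on isomorphism classes and surjective. -/
theorem exists_iso_invariant_surjection_to_bitvectors (n : ℕ)
    (h : Nat.factorial n * 2 ^ n ≤ 2 ^ n.choose 2) :
    ∃ φ : SimpleGraph (Fin n) → (Fin n → Bool),
      (∀ G H : SimpleGraph (Fin n), Nonempty (G ≃g H) → φ G = φ H) ∧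
        Function.Surjective φ := by
  classical
  let S : Setoid (SimpleGraph (Fin n)) :=
    ⟨fun G H => Nonempty (G ≃g H), fun _ => ⟨RelIso.refl _⟩, fun ⟨e⟩ => ⟨e.symm⟩,
      fun ⟨e⟩ ⟨f⟩ => ⟨e.trans f⟩⟩
  have hs : Function.Surjective
      (fun p : Quotient S × Equiv.Perm (Fin n) => (p.1.out).comap p.2) := by
    intro G
    have hr : Nonempty ((Quotient.mk S G).out ≃g G) := Quotient.mk_out (s := S) G
    obtain ⟨e⟩ := hr
    refine ⟨(Quotient.mk S G, e.symm.toEquiv), ?_⟩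
    ext a b
    exact e.symm.map_rel_iff
  have hc := Nat.card_le_card_of_surjective _ hs
  rw [Nat.card_prod, Nat.card_perm, Nat.card_fin] at hc
  have hq : 2 ^ n ≤ Nat.card (Quotient S) := by
    have h4 : n.factorial * 2 ^ n ≤ n.factorial * Nat.card (Quotient S) := by
      have := aux_card_graphs n
      rw [mul_comm _ (Nat.card _)]
      omega
    exact Nat.le_of_mul_le_mul_left h4 n.factorial_pos
  have hemb : Nonempty ((Fin n → Bool) ↪ Quotient S) := by
    let _ := Fintype.ofFinite (Quotient S)
    apply Function.Embedding.nonempty_of_card_le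
    simpa [Nat.card_eq_fintype_card] using hq
  obtain ⟨f⟩ := hemb
  refine ⟨fun G => Function.invFun f (Quotient.mk S G), ?_, ?_⟩
  · intro G H hGH
    exact congrArg _ (Quotient.sound (s := S) hGH)
  · exact (Function.invFun_surjective f.injective).comp Quotient.mk_surjective
end
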